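/- In the standard setup with B = N(u)∪N(v), suppose x and y are distinct vertices on C with x⁺ = b_i ∈ B and y⁻ = b_j ∈ B for some j < i, and xy ∈ E(G). Then x⁻ and y⁺ are not adjacent to any inner vertex of a 2-interval lying on the arc of C from x⁺⁺ to y⁻⁻. -/

import Mathlib

open scoped Classical

namespace Paper

noncomputable section

variable {V : Type*}

/-- degree as cardinality of neighbor set -/
def deg (G : SimpleGraph V) (x : V) : ℕ := (G.neighborSet x).ncard

/-- G is 1-tough -/
def OneTough (G : SimpleGraph V) : Prop :=
  ∀ S : Set V, S.Nonempty → Nat.card ((G.induce Sᶜ).ConnectedComponent) ≤ S.ncard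

def IsIndepTriple (G : SimpleGraph V) (s : Finset V) : Prop :=
  s.card = 3 ∧ ∀ x ∈ s, ∀ y ∈ s, x ≠ y → ¬ G.Adj x y

def sigma3 [Fintype V] (G : SimpleGraph V) : ℕ :=
  if ∃ s : Finset V, IsIndepTriple G s then
    sInf {k | ∃ s : Finset V, IsIndepTriple G s ∧ ∑ x ∈ s, deg G x = k}
  else 3 * (Fintype.card V - 1)

def NC2 [Fintype V] (G : SimpleGraph V) : ℕ :=
  if G = ⊤ then Fintype.card V - 1
  else sInf {k | ∃ x y : V, G.dist x y = 2 ∧ (G.neighborSet x ∪ G.neighborSet y).ncard = k}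

def circumference (G : SimpleGraph V) : ℕ :=
  sSup {k | ∃ (a : V) (w : G.Walk a a), w.IsCycle ∧ w.length = k}

def IsLongestCycle (G : SimpleGraph V) {a : V} (c : G.Walk a a) : Prop :=
  c.IsCycle ∧ ∀ (b : V) (w : G.Walk b b), w.IsCycle → w.length ≤ c.length

/-- successor of a vertex along the oriented cycle `c` (identity off the cycle) -/
def cSucc [DecidableEq V] {G : SimpleGraph V} {a : V} (c : G.Walk a a) (x : V) : V :=
  if h : x ∈ c.support.tail then c.support.tail.next x h else x

/-- predecessor of a vertex along the oriented cycle `c` (identity off the cycle) -/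
def cPred [DecidableEq V] {G : SimpleGraph V} {a : V} (c : G.Walk a a) (x : V) : V :=
  if h : x ∈ c.support.tail then c.support.tail.prev x h else x

/-- vertices strictly between `x` and `y` going forward along `c` -/
def arc [DecidableEq V] {G : SimpleGraph V} {a : V} (c : G.Walk a a) (x y : V) : Set V :=
  {z | ∃ i k : ℕ, 0 < i ∧ i < k ∧ k < c.length ∧ (cSucc c)^[k] x = y ∧ z = (cSucc c)^[i] x}

/-- length of the interval of the cycle `c` starting at `b` determined by `B` -/
def intervalLen [DecidableEq V] {G : SimpleGraph V} {a : V} (c : G.Walk a a)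
    (B : Set V) (b : V) : ℕ :=
  sInf {k | 0 < k ∧ (cSucc c)^[k] b ∈ B}

/-- inner vertices of the interval of the cycle `c` starting at `b` determined by `B` -/
def innerVerts [DecidableEq V] {G : SimpleGraph V} {a : V} (c : G.Walk a a)
    (B : Set V) (b : V) : Set V :=
  {x | ∃ i, 0 < i ∧ i < intervalLen c B b ∧ x = (cSucc c)^[i] b}

/-- the union of the neighborhoods of the vertices in `S` -/
def nbhdSet (G : SimpleGraph V) (S : Set V) : Set V := {z | ∃ y ∈ S, G.Adj y z}

/-- a set of vertices is independent -/
def IsIndepSet (G : SimpleGraph V) (S : Set V) : Prop :=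
  ∀ x ∈ S, ∀ y ∈ S, ¬ G.Adj x y

/-- `l` is the vertex list of a walk from `s` to `t` -/
def IsWalkList (G : SimpleGraph V) (l : List V) (s t : V) : Prop :=
  ∃ w : G.Walk s t, w.support = l

namespace IsWalkList

variable {G : SimpleGraph V} {l l' : List V} {s t s' t' : V}

lemma single (G : SimpleGraph V) (s : V) : IsWalkList G [s] s s := ⟨.nil, rfl⟩

lemma append (h : IsWalkList G l s t) (hadj : G.Adj t s') (h' : IsWalkList G l' s' t') :
    IsWalkList G (l ++ l') s t' := by
  obtain ⟨w, rfl⟩ := h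
  obtain ⟨w', rfl⟩ := h'
  exact ⟨w.append (.cons hadj w'), by simp [SimpleGraph.Walk.support_append]⟩

lemma reverse (h : IsWalkList G l s t) : IsWalkList G l.reverse t s := by
  obtain ⟨w, rfl⟩ := h
  exact ⟨w.reverse, by simp⟩

lemma map_range' {p : ℕ → V} {i n : ℕ} (h : ∀ j, i ≤ j → j < i + n → G.Adj (p j) (p (j + 1))) :
    IsWalkList G ((List.range' i (n + 1)).map p) (p i) (p (i + n)) := by
  induction n with
  | zero => simpa using single G (p i)
  | succ n ih =>
    rw [List.range'_1_concat, List.map_append]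
    exact (ih fun j hj hj' ↦ h j hj (by omega)).append (h (i + n) (by omega) (by omega))
      (single G (p (i + (n + 1))))

lemma map_range'_of_le {p : ℕ → V} {i k : ℕ} (hik : i ≤ k)
    (h : ∀ j, i ≤ j → j < k → G.Adj (p j) (p (j + 1))) :
    IsWalkList G ((List.range' i (k + 1 - i)).map p) (p i) (p k) := by
  obtain ⟨n, rfl⟩ := Nat.exists_eq_add_of_le hik
  rw [show i + n + 1 - i = n + 1 by omega]
  exact map_range' h

lemma exists_cycle (h : IsWalkList G l s t) (hadj : G.Adj t s) (hnd : l.Nodup)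
    (hlen : 3 ≤ l.length) : ∃ c : G.Walk t t, c.IsCycle ∧ c.length = l.length := by
  obtain ⟨w, rfl⟩ := h
  have hw : w.IsPath := ⟨⟨SimpleGraph.Walk.edges_nodup_of_support_nodup hnd⟩, hnd⟩
  refine ⟨.cons hadj w, ?_, by simp⟩
  rw [SimpleGraph.Walk.length_support] at hlen
  rw [SimpleGraph.Walk.isCycle_iff_isPath_tail_and_le_length]
  simpa using ⟨hw, Nat.le_of_succ_le_succ hlen⟩

/-- A path whose ends both have enough neighbours among `u`, `v` may be traversed
so as to link `v` to `u`. -/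
lemma exists_perm_link {u v : V} (h : IsWalkList G l s t) (hus : G.Adj u s) (hvs : G.Adj v s)
    (ht : G.Adj u t ∨ G.Adj v t) :
    ∃ l' s' t', l'.Perm l ∧ IsWalkList G l' s' t' ∧ G.Adj v s' ∧ G.Adj t' u := by
  obtain ht | ht := ht
  · exact ⟨l, s, t, .rfl, h, hvs, ht.symm⟩
  · exact ⟨l.reverse, t, s, l.reverse_perm, h.reverse, ht, hus.symm⟩

end IsWalkList

section Hopping

variable {G : SimpleGraph V} {A B D E : List V} {a₀ a₁ b₀ b₁ d₀ d₁ e₀ e₁ u v x z : V}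

open IsWalkList

/-- The vertices `z`, `v`, `x` occur in this order on the cycle `A z B v D E x`. -/
lemma exists_cycle_of_before
    (hA : IsWalkList G A a₀ a₁) (hB : IsWalkList G B b₀ b₁) (hD : IsWalkList G D d₀ d₁)
    (hE : IsWalkList G E e₀ e₁) (hzB : G.Adj z b₀) (hBv : G.Adj b₁ v) (hvD : G.Adj v d₀)
    (hxA : G.Adj x a₀) (huB : G.Adj u b₁) (huD : G.Adj u d₀) (hxE : G.Adj x e₀)
    (hEz : G.Adj e₁ z) (hAuv : G.Adj u a₁ ∨ G.Adj v a₁) (hDuv : G.Adj u d₁ ∨ G.Adj v d₁) :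
    ∃ l s t, l.Perm (u :: (A ++ z :: (B ++ v :: (D ++ (E ++ [x]))))) ∧
      IsWalkList G l s t ∧ G.Adj t s := by
  obtain ⟨D', p, q, hperm, hD', hvp, hqu⟩ := hD.exists_perm_link huD hvD hDuv
  obtain h | h := hAuv
  · refine ⟨_, _, _, ?_, ((((((((single G u).append h hA.reverse).append hxA.symm
      (single G x)).append hxE hE).append hEz (single G z)).append hzB hB).append hBv
      (single G v)).append hvp hD'), hqu⟩
    rw [List.perm_iff_count] at hperm ⊢
    intro w
    simp [List.count_cons, hperm]
    omega
  · refine ⟨_, _, _, ?_, ((((((((single G u).append huB hB.reverse).append hzB.symm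
      (single G z)).append hEz.symm hE.reverse).append hxE.symm (single G x)).append hxA hA).append
      h.symm (single G v)).append hvp hD'), hqu⟩
    rw [List.perm_iff_count] at hperm ⊢
    intro w
    simp [List.count_cons, hperm]
    omega

/-- The vertices `v`, `z`, `x` occur in this order on the cycle `A v B z D E x`. -/
lemma exists_cycle_of_after
    (hA : IsWalkList G A a₀ a₁) (hB : IsWalkList G B b₀ b₁) (hD : IsWalkList G D d₀ d₁)
    (hE : IsWalkList G E e₀ e₁) (hAv : G.Adj a₁ v) (hvB : G.Adj v b₀) (hzD : G.Adj z d₀)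
    (hxA : G.Adj x a₀) (huA : G.Adj u a₁) (huB : G.Adj u b₀) (hxE : G.Adj x e₀)
    (hEz : G.Adj e₁ z) (hBuv : G.Adj u b₁ ∨ G.Adj v b₁) (hDuv : G.Adj u d₁ ∨ G.Adj v d₁) :
    ∃ l s t, l.Perm (u :: (A ++ v :: (B ++ z :: (D ++ (E ++ [x]))))) ∧
      IsWalkList G l s t ∧ G.Adj t s := by
  obtain h | h := hDuv
  · obtain ⟨B', p, q, hperm, hB', hup, hqv⟩ := hB.exists_perm_link hvB huB hBuv.symm
    refine ⟨_, _, _, ?_, ((((((((single G u).append hup hB').append hqv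
      (single G v)).append hAv.symm hA.reverse).append hxA.symm (single G x)).append hxE hE).append
      hEz (single G z)).append hzD hD), h.symm⟩
    rw [List.perm_iff_count] at hperm ⊢
    intro w
    simp [List.count_cons, hperm]
    omega
  · obtain ⟨B', p, q, hperm, hB', hvp, hqu⟩ := hB.exists_perm_link huB hvB hBuv
    refine ⟨_, _, _, ?_, ((((((((single G u).append huA hA.reverse).append hxA.symm
      (single G x)).append hxE hE).append hEz (single G z)).append hzD hD).append h.symm
      (single G v)).append hvp hB'), hqu⟩
    rw [List.perm_iff_count] at hperm ⊢
    intro w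
    simp [List.count_cons, hperm]
    omega

/-- The vertices `v`, `x` occur on the cycle `A v D E x`. -/
lemma exists_cycle_of_eq
    (hA : IsWalkList G A a₀ a₁) (hD : IsWalkList G D d₀ d₁) (hE : IsWalkList G E e₀ e₁)
    (hvD : G.Adj v d₀) (hxA : G.Adj x a₀) (huA : G.Adj u a₁) (huD : G.Adj u d₀)
    (hxE : G.Adj x e₀) (hEv : G.Adj e₁ v) (hDuv : G.Adj u d₁ ∨ G.Adj v d₁) :
    ∃ l s t, l.Perm (u :: (A ++ v :: (D ++ (E ++ [x])))) ∧
      IsWalkList G l s t ∧ G.Adj t s := by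
  obtain ⟨D', p, q, hperm, hD', hvp, hqu⟩ := hD.exists_perm_link huD hvD hDuv
  refine ⟨_, _, _, ?_, ((((((single G u).append huA hA.reverse).append hxA.symm
    (single G x)).append hxE hE).append hEv (single G v)).append hvp hD'), hqu⟩
  rw [List.perm_iff_count] at hperm ⊢
  intro w
  simp [List.count_cons, hperm]
  omega

/-- The vertices `x` and `x⁺` are the last and the first one on the cycle `A v D`. -/
lemma exists_cycle_of_adj_consecutive
    (hA : IsWalkList G A a₀ a₁) (hD : IsWalkList G D d₀ d₁) (hAv : G.Adj a₁ v) (hvD : G.Adj v d₀)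
    (huA : G.Adj u a₁) (huD : G.Adj u d₀)
    (hAuv : G.Adj u a₀ ∨ G.Adj v a₀) (hDuv : G.Adj u d₁ ∨ G.Adj v d₁) :
    ∃ l s t, l.Perm (u :: (A ++ v :: D)) ∧ IsWalkList G l s t ∧ G.Adj t s := by
  obtain ⟨D', p, q, hperm, hD', hvp, hqu⟩ := hD.exists_perm_link huD hvD hDuv
  obtain ⟨A', p', q', hperm', hA', hup, hqv⟩ :=
    hA.reverse.exists_perm_link hAv.symm huA hAuv.symm
  refine ⟨_, _, _, ?_, ((((single G u).append hup hA').append hqv (single G v)).append hvp hD'),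
    hqu⟩
  rw [List.perm_iff_count] at hperm hperm' ⊢
  intro w
  simp [List.count_cons, hperm, hperm']

lemma range'_eq_append_cons {s t n : ℕ} (hst : s ≤ t) (htn : t < n) :
    List.range' s (n - s) = List.range' s (t - s) ++ t :: List.range' (t + 1) (n - (t + 1)) := by
  obtain ⟨a, rfl⟩ := Nat.exists_eq_add_of_le hst
  obtain ⟨b, rfl⟩ := Nat.exists_eq_add_of_lt htn
  rw [show s + a + b + 1 - s = a + (b + 1) by omega, show s + a - s = a by omega,
    show s + a + b + 1 - (s + a + 1) = b by omega, ← List.range'_append_1, List.range'_succ]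

lemma range_eq_append_three {i k m : ℕ} (hi : i < k) (hk : k + 2 < m) :
    List.range m = List.range' 0 i ++ i :: (List.range' (i + 1) (k - i) ++
      (List.range' (k + 1) (m - 2 - k) ++ [m - 1])) := by
  have h₀ := range'_eq_append_cons (Nat.zero_le i) (show i < m by omega)
  have h₁ := range'_eq_append_cons (show i + 1 ≤ m - 1 by omega) (show m - 1 < m by omega)
  have h₂ : List.range' (i + 1) (m - 1 - (i + 1)) =
      List.range' (i + 1) (k - i) ++ List.range' (k + 1) (m - 2 - k) := by
    rw [show m - 1 - (i + 1) = k - i + (m - 2 - k) by omega, ← List.range'_append_1,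
      show i + 1 + (k - i) = k + 1 by omega]
  have h₃ : m - (m - 1 + 1) = 0 := by omega
  simp only [Nat.sub_zero] at h₀
  rw [List.range_eq_range', h₀, h₁, h₂, h₃, List.range'_zero, List.append_assoc]

lemma range_eq_append_four {i j k m : ℕ} (hij : i < j) (hj : j < k) (hk : k + 2 < m) :
    List.range m = List.range' 0 i ++ i :: (List.range' (i + 1) (j - i - 1) ++
      j :: (List.range' (j + 1) (k - j) ++ (List.range' (k + 1) (m - 2 - k) ++ [m - 1]))) := by
  rw [range_eq_append_three (hij.trans hj) hk,
    show k - i = k + 1 - (i + 1) by omega, range'_eq_append_cons hij (show j < k + 1 by omega),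
    show k + 1 - (j + 1) = k - j by omega, show j - (i + 1) = j - i - 1 by omega]
  simp only [List.append_assoc, List.cons_append]

/-- Let `p 0, …, p (m - 1)` be a cycle, `v = p i`, `z = p j`, `x = p (m - 1)`, `y = p (k + 1)`.
If `x` is adjacent to `y` and the predecessor of `x` to `z`, then `u` can be added to the cycle. -/
lemma exists_cycle_insert {p : ℕ → V} {i j k m : ℕ} (hi : 0 < i) (hik : i < k) (hj : 0 < j)
    (hjk : j < k) (hkm : k + 2 < m) (hp : ∀ t, t + 1 < m → G.Adj (p t) (p (t + 1)))
    (hclose : G.Adj (p (m - 1)) (p 0)) (hu₁ : G.Adj u (p (i - 1))) (hu₂ : G.Adj u (p (i + 1)))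
    (hk : G.Adj u (p k) ∨ G.Adj (p i) (p k))
    (hjuv : G.Adj u (p (j - 1)) ∨ G.Adj (p i) (p (j - 1)))
    (hji : j ≠ i + 1) (hij : i ≠ j + 1)
    (hxy : G.Adj (p (m - 1)) (p (k + 1))) (hxz : G.Adj (p (m - 2)) (p j)) :
    ∃ l s t, l.Perm (u :: (List.range m).map p) ∧ IsWalkList G l s t ∧ G.Adj t s := by
  have seg (a b : ℕ) (hab : a ≤ b) (hb : b < m) :=
    map_range'_of_le hab fun t _ _ ↦ hp t (by omega)
  have hp' (s t : ℕ) (hst : s + 1 = t) (ht : t < m) : G.Adj (p s) (p t) := by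
    subst hst; exact hp s ht
  have hE : IsWalkList G ((List.range' (k + 1) (m - 2 - k)).map p) (p (k + 1)) (p (m - 2)) := by
    convert seg (k + 1) (m - 2) (by omega) (by omega) using 3; omega
  obtain hlt | rfl | hlt := lt_trichotomy j i
  · have hA := seg 0 (j - 1) (by omega) (by omega)
    have hB := seg (j + 1) (i - 1) (by omega) (by omega)
    have hD := seg (i + 1) k (by omega) (by omega)
    rw [range_eq_append_four hlt hik hkm]
    rw [show j - 1 + 1 - 0 = j by omega] at hA
    rw [show i - 1 + 1 - (j + 1) = i - j - 1 by omega] at hB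
    rw [show k + 1 - (i + 1) = k - i by omega] at hD
    simpa using exists_cycle_of_before hA hB hD hE (hp' _ _ rfl (by omega))
      (hp' _ _ (by omega) (by omega)) (hp' _ _ rfl (by omega)) hclose hu₁ hu₂ hxy hxz hjuv hk
  · have hA := seg 0 (j - 1) (by omega) (by omega)
    have hD := seg (j + 1) k (by omega) (by omega)
    rw [range_eq_append_three hik hkm]
    rw [show j - 1 + 1 - 0 = j by omega] at hA
    rw [show k + 1 - (j + 1) = k - j by omega] at hD
    simpa using exists_cycle_of_eq hA hD hE (hp' _ _ rfl (by omega)) hclose hu₁ hu₂ hxy hxz hk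
  · have hA := seg 0 (i - 1) (by omega) (by omega)
    have hB := seg (i + 1) (j - 1) (by omega) (by omega)
    have hD := seg (j + 1) k (by omega) (by omega)
    rw [range_eq_append_four hlt hjk hkm]
    rw [show i - 1 + 1 - 0 = i by omega] at hA
    rw [show j - 1 + 1 - (i + 1) = j - i - 1 by omega] at hB
    rw [show k + 1 - (j + 1) = k - j by omega] at hD
    simpa using exists_cycle_of_after hA hB hD hE (hp' _ _ (by omega) (by omega))
      (hp' _ _ rfl (by omega)) (hp' _ _ rfl (by omega)) hclose hu₁ hu₂ hxy hxz hjuv hk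

/-- If two consecutive vertices of a cycle are adjacent to `u` or to a vertex `p i` both of whose
neighbours on the cycle are adjacent to `u`, then `u` can be added to the cycle. -/
lemma exists_cycle_insert_of_consecutive {p : ℕ → V} {i m : ℕ} (hi : 0 < i) (him : i + 1 < m)
    (hp : ∀ t, t + 1 < m → G.Adj (p t) (p (t + 1)))
    (hu₁ : G.Adj u (p (i - 1))) (hu₂ : G.Adj u (p (i + 1)))
    (h₀ : G.Adj u (p 0) ∨ G.Adj (p i) (p 0))
    (h₁ : G.Adj u (p (m - 1)) ∨ G.Adj (p i) (p (m - 1))) :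
    ∃ l s t, l.Perm (u :: (List.range m).map p) ∧ IsWalkList G l s t ∧ G.Adj t s := by
  have hA := map_range'_of_le (Nat.zero_le (i - 1)) fun t _ _ ↦ hp t (by omega)
  have hD := map_range'_of_le (show i + 1 ≤ m - 1 by omega) fun t _ _ ↦ hp t (by omega)
  have hAv := hp (i - 1) (by omega)
  rw [show i - 1 + 1 - 0 = i - 0 by omega] at hA
  rw [show m - 1 + 1 - (i + 1) = m - (i + 1) by omega] at hD
  rw [Nat.sub_add_cancel hi] at hAv
  rw [List.range_eq_range', ← Nat.sub_zero m,
    range'_eq_append_cons (Nat.zero_le i) (show i < m by omega)]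
  simpa using exists_cycle_of_adj_consecutive hA hD hAv (hp i him) hu₁ hu₂ h₀ h₁

end Hopping

section Orientation

variable {G : SimpleGraph V} {a : V} {c : G.Walk a a}

lemma mem_support_tail (hc : c.IsCycle) {x : V} : x ∈ c.support.tail ↔ x ∈ c.support := by
  rw [SimpleGraph.Walk.mem_support_iff]
  refine ⟨Or.inr, ?_⟩
  rintro (rfl | h)
  · exact SimpleGraph.Walk.end_mem_tail_support (hc.not_nil)
  · exact h

variable [DecidableEq V]

lemma cPred_cSucc (hc : c.IsCycle) (x : V) : cPred c (cSucc c x) = x := by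
  unfold cSucc cPred
  split_ifs with h h'
  · exact List.prev_next _ hc.support_nodup _ h
  · exact absurd (List.next_mem _ _ h) h'
  · rfl

lemma cSucc_cPred (hc : c.IsCycle) (x : V) : cSucc c (cPred c x) = x := by
  unfold cSucc cPred
  split_ifs with h h'
  · exact List.next_prev _ hc.support_nodup _ h
  · exact absurd (List.prev_mem _ _ h) h'
  · rfl

lemma iterate_cSucc_getElem (hc : c.IsCycle) {s : ℕ} (hs : s < c.support.tail.length) (t : ℕ) :
    (cSucc c)^[t] c.support.tail[s] =
      c.support.tail[(s + t) % c.support.tail.length]'(Nat.mod_lt _ (by omega)) := by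
  induction t with
  | zero => simp only [Function.iterate_zero, id_eq, add_zero, Nat.mod_eq_of_lt hs]
  | succ t ih =>
    rw [Function.iterate_succ_apply', ih, cSucc, dif_pos (List.getElem_mem _),
      List.next_getElem _ hc.support_nodup]
    congr 1
    rw [Nat.mod_add_mod, add_assoc]

lemma iterate_cSucc_eq_iff (hc : c.IsCycle) {x : V} (hx : x ∈ c.support) {s t : ℕ} :
    (cSucc c)^[s] x = (cSucc c)^[t] x ↔ s ≡ t [MOD c.length] := by
  obtain ⟨r, hr, rfl⟩ := List.getElem_of_mem ((mem_support_tail hc).2 hx)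
  rw [iterate_cSucc_getElem hc hr, iterate_cSucc_getElem hc hr, hc.support_nodup.getElem_inj_iff]
  have : c.support.tail.length = c.length := by simp
  rw [this]
  exact ⟨Nat.ModEq.add_left_cancel' r, Nat.ModEq.add_left r⟩

lemma iterate_cSucc_mem_support (hc : c.IsCycle) {x : V} (hx : x ∈ c.support) (t : ℕ) :
    (cSucc c)^[t] x ∈ c.support := by
  obtain ⟨r, hr, rfl⟩ := List.getElem_of_mem ((mem_support_tail hc).2 hx)
  rw [iterate_cSucc_getElem hc hr]
  exact List.mem_of_mem_tail (List.getElem_mem _)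

lemma adj_cSucc (hc : c.IsCycle) {x : V} (hx : x ∈ c.support) : G.Adj x (cSucc c x) := by
  obtain ⟨r, hr, rfl⟩ := List.getElem_of_mem ((mem_support_tail hc).2 hx)
  have h := iterate_cSucc_getElem hc hr 1
  have hlen : c.support.tail.length = c.length := by simp
  have hchain := c.isChain_adj_support
  rw [Function.iterate_one] at h
  rw [h]
  simp only [List.getElem_tail]
  obtain hlt | heq : r + 1 < c.support.tail.length ∨ r + 1 = c.support.tail.length := by omega
  · simp only [Nat.mod_eq_of_lt hlt]
    exact hchain.getElem _ _
  · simp only [heq, Nat.mod_self, hlen, zero_add]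
    have h0 : c.support[c.length]'(by simp) = c.support[0]'(by simp) := by
      simp
    rw [h0]
    exact hchain.getElem 0 (by simp; omega)

end Orientation

theorem stmt13 {V : Type*} [Fintype V] [DecidableEq V] (G : SimpleGraph V)
    (hn : 3 ≤ Fintype.card V) (htough : OneTough G) (hsig : Fintype.card V ≤ sigma3 G)
    (hham : ¬ G.IsHamiltonian) {a : V} (c : G.Walk a a) (hc : IsLongestCycle G c)
    (u v : V) (hu : u ∉ c.support) (hv : v ∈ c.support)
    (huv1 : G.Adj u (cSucc c v)) (huv2 : G.Adj u (cPred c v))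
    (B : Set V) (hB : B = G.neighborSet u ∪ G.neighborSet v)
    (x y : V) (hx : x ∈ c.support) (hy : y ∈ c.support) (hxy : x ≠ y)
    (hxB : cSucc c x ∈ B) (hyB : cPred c y ∈ B)
    (horder : v ∈ arc c (cSucc c x) (cPred c y))
    (hadj : G.Adj x y) :
    ∀ z, z ∈ arc c (cSucc c x) (cPred c y) →
      cPred c z ∈ B → cSucc c z ∈ B → z ∉ B →
      ¬ G.Adj (cPred c x) z ∧ ¬ G.Adj (cSucc c y) z := by
  intro z hz hz₁ hz₂ hzB
  obtain ⟨hcyc, hmax⟩ := hc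
  set m := c.length with hm
  set p : ℕ → V := fun t ↦ (cSucc c)^[t] (cSucc c x) with hpdef
  have hx' : cSucc c x ∈ c.support := iterate_cSucc_mem_support hcyc hx 1
  have hpmem (t : ℕ) : p t ∈ c.support := iterate_cSucc_mem_support hcyc hx' t
  have hpeq {s t : ℕ} : p s = p t ↔ s ≡ t [MOD m] := iterate_cSucc_eq_iff hcyc hx'
  have hinj {s t : ℕ} (hs : s < m) (ht : t < m) (h : p s = p t) : s = t :=
    (hpeq.1 h).eq_of_lt_of_lt hs ht
  have hper (t : ℕ) : p (t + m) = p t := hpeq.2 (by simp [Nat.ModEq])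
  have hsucc (t : ℕ) : cSucc c (p t) = p (t + 1) := (Function.iterate_succ_apply' _ _ _).symm
  have hpred (t : ℕ) : cPred c (p (t + 1)) = p t := by rw [← hsucc, cPred_cSucc hcyc]
  have hadjp (t : ℕ) : G.Adj (p t) (p (t + 1)) := hsucc t ▸ adj_cSucc hcyc (hpmem t)
  have hm3 : 3 ≤ m := hcyc.three_le_length
  have hfalse (q : ℕ → V) (hq : ∀ t, q t ∈ c.support)
      (hqinj : ∀ s t, s < m → t < m → q s = q t → s = t) :
      ¬ ∃ l s t, l.Perm (u :: (List.range m).map q) ∧ IsWalkList G l s t ∧ G.Adj t s := by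
    rintro ⟨l, s, t, hperm, hl, hts⟩
    have hlen : l.length = m + 1 := by simp [hperm.length_eq]
    have hnd : l.Nodup := by
      rw [hperm.nodup_iff, List.nodup_cons]
      refine ⟨fun h ↦ ?_, List.nodup_range.map_on fun s hs t ht ↦
        hqinj s t (List.mem_range.1 hs) (List.mem_range.1 ht)⟩
      obtain ⟨t, -, rfl⟩ := List.mem_map.1 h
      exact hu (hq t)
    obtain ⟨w, hw, hwlen⟩ := hl.exists_cycle hts hnd (by omega)
    have := hmax _ w hw
    omega
  have hB' (w : V) : w ∈ B ↔ G.Adj u w ∨ G.Adj v w := by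
    rw [hB]; rfl
  obtain ⟨i, k, hi, hik, hkm, hky, hvi⟩ := horder
  obtain ⟨j, k', hj, hjk, hkm', hky', hzj⟩ := hz
  change p k = _ at hky
  change p k' = _ at hky'
  change v = p i at hvi
  change z = p j at hzj
  obtain rfl : k = k' := hinj hkm hkm' (hky.trans hky'.symm)
  have hpx : p (m - 1) = x := by
    have h : p (m - 1 + 1) = p 0 := by rw [← hper 0]; congr 1; omega
    rw [← hpred, h]
    exact cPred_cSucc hcyc x
  have hpy : p (k + 1) = y := by rw [← hsucc, hky, cSucc_cPred hcyc]
  have hpx' : cPred c x = p (m - 2) := by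
    rw [← hpx, show m - 1 = m - 2 + 1 by omega, hpred]
  have hpy' : cSucc c y = p (k + 2) := by rw [← hpy, hsucc]
  obtain ⟨i, rfl⟩ := Nat.exists_eq_add_of_lt hi
  obtain ⟨j, rfl⟩ := Nat.exists_eq_add_of_lt hj
  simp only [zero_add] at *
  subst hvi hzj
  rw [hsucc] at huv1 hz₂
  rw [hpred] at huv2 hz₁
  rw [← hky, hB'] at hyB
  rw [show cSucc c x = p 0 from rfl, hB'] at hxB
  rw [hB'] at hz₁ hz₂
  rw [← hpx, ← hpy] at hadj
  have hclose : G.Adj (p (m - 1)) (p 0) := hpx ▸ adj_cSucc hcyc hx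
  have hji : j + 1 ≠ i + 1 + 1 := fun h ↦ hzB ((hB' _).2 (Or.inl (h ▸ huv1)))
  have hij : i + 1 ≠ j + 1 + 1 := by
    rintro h
    obtain rfl : i = j + 1 := by omega
    exact hzB ((hB' _).2 (Or.inl huv2))
  have hk₁ : k ≠ m - 1 := by
    rintro rfl
    exact hfalse p hpmem (fun _ _ ↦ hinj)
      (exists_cycle_insert_of_consecutive hi (by omega) (fun t _ ↦ hadjp t) huv2 huv1 hxB hyB)
  have hk₂ : k + 1 ≠ m - 1 := fun h ↦ hxy (by rw [← hpx, ← hpy, h])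
  have hk : k + 2 < m := by omega
  rw [hpx', hpy']
  refine ⟨fun h ↦ ?_, fun h ↦ ?_⟩
  · exact hfalse p hpmem (fun _ _ ↦ hinj) (exists_cycle_insert hi hik hj hjk hk (fun t _ ↦ hadjp t)
      hclose huv2 huv1 hyB hz₁ hji hij hadj h)
  · have hq {s t : ℕ} (hst : s + t = k) : p (k + m - s) = p t := by
      rw [← hper t]; congr 1; omega
    have hq' {s t : ℕ} (hst : s + t = k + m) : p (k + m - s) = p t := by
      congr 1; omega
    refine hfalse (fun t ↦ p (k + m - t)) (fun _ ↦ hpmem _) (fun s t hs ht hst ↦ ?_)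
      (exists_cycle_insert (i := k - (i + 1)) (j := k - (j + 1)) (k := k) (by omega) (by omega)
        (by omega) (by omega) hk ?_ ?_ ?_ ?_ ?_ ?_ (by omega) (by omega) ?_ ?_)
    · have h₁ := (hpeq.1 hst).add_right (s + t)
      rw [show k + m - s + (s + t) = k + m + t by omega,
        show k + m - t + (s + t) = k + m + s by omega] at h₁
      exact (h₁.add_left_cancel'.symm).eq_of_lt_of_lt hs ht
    · intro t ht
      have := hadjp (k + m - (t + 1))
      rw [show k + m - (t + 1) + 1 = k + m - t by omega] at this
      exact this.symm
    · rw [hq' (s := m - 1) (t := k + 1) (by omega), hq (s := 0) (t := k) (by omega)]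
      exact (hadjp k).symm
    · rwa [hq (t := i + 1 + 1) (by omega)]
    · rwa [hq (t := i) (by omega)]
    · rwa [hq (s := k) (t := 0) (by omega), hq (t := i + 1) (by omega)]
    · rwa [hq (t := j + 1 + 1) (by omega), hq (t := i + 1) (by omega)]
    · rw [hq' (s := m - 1) (t := k + 1) (by omega), hq' (s := k + 1) (t := m - 1) (by omega)]
      exact hadj.symm
    · rwa [hq' (s := m - 2) (t := k + 2) (by omega), hq (t := j + 1) (by omega)]

end
end Paper
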